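/- arXiv:1510.02848 — 2 statements merged into one kernel-verified Lean document; each statement's English description precedes it below -/
import Mathlib

section
/- Assume G and the subgraph G_I induced on the interior nodes are connected. If there exist ρ_1, ρ_2 ∈ ℂ_0^E such that P(ρ_1,ρ_2) = ℂ^E, then the set {(γ_1,γ_2) ∈ ℂ_0^E × ℂ_0^E : P(γ_1,γ_2) ≠ ℂ^E} has Lebesgue measure zero in ℂ^E × ℂ^E; in other words, P(γ_1,γ_2) = ℂ^E for almost all (γ_1,γ_2) ∈ ℂ_0^E × ℂ_0^E. -/
/-!
Common setup: a finite graph whose vertex set is partitioned into boundary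
nodes `B` and interior nodes `I` (so the vertex set is `B ⊕ I`), with edge
set `E` and a fixed orientation given by maps `head tail : E → B ⊕ I`.
-/

open Matrix MeasureTheory

namespace DIP

noncomputable section

variable {B I E : Type*} [Fintype B] [Fintype I] [Fintype E]
  [DecidableEq B] [DecidableEq I] [DecidableEq E]

/-- Discrete gradient: `(∇u)(e) = u(head e) - u(tail e)`. -/
def grad (head tail : E → B ⊕ I) (u : B ⊕ I → ℂ) : E → ℂ :=
  fun e => u (head e) - u (tail e)

/-- Signed incidence matrix over a commutative ring `α`. -/
def incMat (α : Type*) [CommRing α] (head tail : E → B ⊕ I) : Matrix E (B ⊕ I) α :=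
  Matrix.of fun e v => (if v = head e then (1 : α) else 0) - (if v = tail e then (1 : α) else 0)

/-- Weighted graph Laplacian `L_γ = ∇ᵀ diag(γ) ∇`. -/
def lap (α : Type*) [CommRing α] (head tail : E → B ⊕ I) (γ : E → α) :
    Matrix (B ⊕ I) (B ⊕ I) α :=
  (incMat α head tail)ᵀ * Matrix.diagonal γ * incMat α head tail

/-- The `II` block of the weighted graph Laplacian. -/
def lapII (α : Type*) [CommRing α] (head tail : E → B ⊕ I) (γ : E → α) : Matrix I I α :=
  (lap α head tail γ).submatrix Sum.inr Sum.inr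

/-- The `IB` block of the weighted graph Laplacian. -/
def lapIB (α : Type*) [CommRing α] (head tail : E → B ⊕ I) (γ : E → α) : Matrix I B α :=
  (lap α head tail γ).submatrix Sum.inr Sum.inl

/-- The `BI` block of the weighted graph Laplacian. -/
def lapBI (α : Type*) [CommRing α] (head tail : E → B ⊕ I) (γ : E → α) : Matrix B I α :=
  (lap α head tail γ).submatrix Sum.inl Sum.inr

/-- The `BB` block of the weighted graph Laplacian. -/
def lapBB (α : Type*) [CommRing α] (head tail : E → B ⊕ I) (γ : E → α) : Matrix B B α :=
  (lap α head tail γ).submatrix Sum.inl Sum.inl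

/-- Dirichlet-to-Neumann map
`Λ_{γ,q} = (L_γ)_BB - (L_γ)_BI [(L_γ)_II + diag(q)]⁻¹ (L_γ)_IB`. -/
def dtn (head tail : E → B ⊕ I) (γ : E → ℂ) (q : I → ℂ) : Matrix B B ℂ :=
  lapBB ℂ head tail γ -
    lapBI ℂ head tail γ * (lapII ℂ head tail γ + Matrix.diagonal q)⁻¹ * lapIB ℂ head tail γ

/-- `u` is `(γ,q)`-harmonic: `(L_γ u)_I + q ⊙ u_I = 0`. -/
def Harmonic (head tail : E → B ⊕ I) (γ : E → ℂ) (q : I → ℂ) (u : B ⊕ I → ℂ) : Prop :=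
  ∀ i : I, (lap ℂ head tail γ).mulVec u (Sum.inr i) + q i * u (Sum.inr i) = 0

/-- The graph `G` is connected. -/
def Gconn (head tail : E → B ⊕ I) : Prop :=
  (SimpleGraph.fromRel fun v w : B ⊕ I => ∃ e, head e = v ∧ tail e = w).Connected

/-- The subgraph of `G` induced on the interior nodes is connected. -/
def GIconn (head tail : E → B ⊕ I) : Prop :=
  (SimpleGraph.fromRel fun i j : I => ∃ e, head e = Sum.inr i ∧ tail e = Sum.inr j).Connected

/-- `P(γ₁,γ₂)`: span of Hadamard products of gradients of harmonic functions. -/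
def Pspace (head tail : E → B ⊕ I) (γ₁ γ₂ : E → ℂ) : Submodule ℂ (E → ℂ) :=
  Submodule.span ℂ { w : E → ℂ | ∃ u v : B ⊕ I → ℂ,
    Harmonic head tail γ₁ 0 u ∧ Harmonic head tail γ₂ 0 v ∧
    w = fun e => grad head tail u e * grad head tail v e }

/-- `Q(q₁,q₂)`: span of Hadamard products of interior values of harmonic functions. -/
def Qspace (head tail : E → B ⊕ I) (γ : E → ℂ) (q₁ q₂ : I → ℂ) : Submodule ℂ (I → ℂ) :=
  Submodule.span ℂ { w : I → ℂ | ∃ u v : B ⊕ I → ℂ,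
    Harmonic head tail γ q₁ u ∧ Harmonic head tail γ q₂ v ∧
    w = fun i => u (Sum.inr i) * v (Sum.inr i) }

/-- The matrix `U(γ)` whose `i`-th column is the harmonic extension of the
standard basis vector `e_i ∈ ℂ^B`. -/
def Usol (head tail : E → B ⊕ I) (γ : E → ℂ) : Matrix (B ⊕ I) B ℂ :=
  Matrix.of (Sum.elim (fun b i => if b = i then (1 : ℂ) else 0)
    (fun j i => (-((lapII ℂ head tail γ)⁻¹ * lapIB ℂ head tail γ)) j i))

/-- The products-of-gradients matrix `F(γ₁,γ₂) ∈ ℂ^{|E| × |B|²}` whose column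
indexed by `(i,j)` is `(∇ U(γ₁))_{:,i} ⊙ (∇ U(γ₂))_{:,j}`. -/
def Fmat (head tail : E → B ⊕ I) (γ₁ γ₂ : E → ℂ) : Matrix E (B × B) ℂ :=
  Matrix.of fun e p =>
    grad head tail (fun v => Usol head tail γ₁ v p.1) e *
    grad head tail (fun v => Usol head tail γ₂ v p.2) e

/-- Smallest eigenvalue of a real symmetric matrix, as the minimum of its
Rayleigh quotient over the (Euclidean) unit sphere. -/
def lambdaMin (M : Matrix I I ℝ) : ℝ :=
  ⨅ x : { x : I → ℝ // ∑ i, x i ^ 2 = 1 }, (x : I → ℝ) ⬝ᵥ M.mulVec (x : I → ℝ)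


/-- Zero sets of nontrivial entire functions are null. -/
def NullZ (V : Type*) [NormedAddCommGroup V] [NormedSpace ℂ V] [MeasureSpace V] : Prop :=
  ∀ f : V → ℂ, Differentiable ℂ f → (∃ x, f x ≠ 0) → volume {x | f x = 0} = 0

theorem nullZ_complex : NullZ ℂ := by
  rintro f hf ⟨x, hx⟩
  have ha : AnalyticOnNhd ℂ f Set.univ := fun z _ => hf.analyticAt z
  have h := ha.preimage_zero_mem_codiscrete (x := x) hx
  have h2 := ae_restrict_le_codiscreteWithin (μ := (volume : Measure ℂ)) MeasurableSet.univ h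
  rw [Measure.restrict_univ, mem_ae_iff] at h2
  refine measure_mono_null ?_ h2
  intro z hz
  simpa using hz

theorem nullZ_prod {V W : Type*} [NormedAddCommGroup V] [NormedSpace ℂ V] [MeasureSpace V]
    [NormedAddCommGroup W] [NormedSpace ℂ W] [MeasureSpace W] [OpensMeasurableSpace (V × W)]
    [SFinite (volume : Measure W)] [SFinite (volume : Measure V)]
    (hV : NullZ V) (hW : NullZ W) : NullZ (V × W) := by
  rintro f hf ⟨⟨a, b⟩, hx⟩
  have hm : MeasurableSet {x | f x = 0} :=
    (isClosed_singleton.preimage hf.continuous).measurableSet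
  rw [Measure.volume_eq_prod, Measure.measure_prod_null hm]
  have h1 : volume {v | f (v, b) = 0} = 0 :=
    hV (fun v => f (v, b)) (by fun_prop) ⟨a, hx⟩
  have h2 : ∀ᵐ v ∂(volume : Measure V), f (v, b) ≠ 0 := by
    rw [ae_iff]; simpa using h1
  filter_upwards [h2] with v hv
  exact hW (fun w => f (v, w)) (by fun_prop) ⟨b, hv⟩

theorem nullZ_transfer {V W : Type*} [NormedAddCommGroup V] [NormedSpace ℂ V] [MeasureSpace V]
    [NormedAddCommGroup W] [NormedSpace ℂ W] [MeasureSpace W] [OpensMeasurableSpace W]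
    (hV : NullZ V) (φ : V → W) (hφ : Differentiable ℂ φ) (hs : Function.Surjective φ)
    (hmp : MeasurePreserving φ volume volume) : NullZ W := by
  rintro f hf ⟨x, hx⟩
  have hm : MeasurableSet {x | f x = 0} :=
    (isClosed_singleton.preimage hf.continuous).measurableSet
  rw [← hmp.measure_preimage hm.nullMeasurableSet]
  obtain ⟨y, rfl⟩ := hs x
  exact hV (fun v => f (φ v)) (by fun_prop) ⟨y, hx⟩

theorem nullZ_fin (n : ℕ) : NullZ (Fin n → ℂ) := by
  induction n with
  | zero =>
    rintro f hf ⟨x, hx⟩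
    have : {x | f x = 0} = ∅ := by
      ext y
      rw [Subsingleton.elim y x]
      simpa using hx
    rw [this]; simp
  | succ n ih =>
    refine nullZ_transfer (nullZ_prod nullZ_complex ih)
      (MeasurableEquiv.piFinSuccAbove (fun _ => ℂ) 0).symm ?_ (MeasurableEquiv.surjective _)
      (volume_preserving_piFinSuccAbove (fun _ => ℂ) 0).symm
    rw [differentiable_pi]
    intro i
    refine Fin.cases ?_ (fun j => ?_) i
    · simp [MeasurableEquiv.piFinSuccAbove, differentiable_fst]
    · simp [MeasurableEquiv.piFinSuccAbove]
      fun_prop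

theorem nullZ_pi (E : Type*) [Fintype E] : NullZ (E → ℂ) := by
  let e := (Fintype.equivFin E).symm
  refine nullZ_transfer (nullZ_fin (Fintype.card E))
    (MeasurableEquiv.piCongrLeft (fun _ => ℂ) e) ?_ (MeasurableEquiv.surjective _)
    (volume_measurePreserving_piCongrLeft (fun _ => ℂ) e)
  rw [differentiable_pi]
  intro i
  obtain ⟨j, rfl⟩ := e.surjective i
  have : (fun x : Fin (Fintype.card E) → ℂ =>
      MeasurableEquiv.piCongrLeft (fun _ => ℂ) e x (e j)) = fun x => x j := by
    funext x
    exact Equiv.piCongrLeft_apply_apply (fun _ => ℂ) e x j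
  rw [this]
  fun_prop

theorem differentiable_det {V : Type*} [NormedAddCommGroup V] [NormedSpace ℂ V]
    {n : Type*} [Fintype n] [DecidableEq n] (M : V → Matrix n n ℂ)
    (hM : ∀ i j, Differentiable ℂ fun x => M x i j) : Differentiable ℂ fun x => (M x).det := by
  simp only [Matrix.det_apply']
  refine Differentiable.fun_sum fun σ _ => ?_
  refine (differentiable_const _).mul ?_
  induction (Finset.univ : Finset n) using Finset.induction_on with
  | empty => simp
  | insert a t ha ih =>
    simp only [Finset.prod_insert ha]
    exact (hM _ _).mul ih

theorem differentiable_adj {V : Type*} [NormedAddCommGroup V] [NormedSpace ℂ V]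
    {n : Type*} [Fintype n] [DecidableEq n] (M : V → Matrix n n ℂ)
    (hM : ∀ i j, Differentiable ℂ fun x => M x i j) (i j : n) :
    Differentiable ℂ fun x => (M x).adjugate i j := by
  simp only [Matrix.adjugate_apply]
  refine differentiable_det _ fun k l => ?_
  by_cases h : k = j
  · subst h; simp
  · simpa [Matrix.updateRow_ne h] using hM k l

theorem differentiable_lap (head tail : E → B ⊕ I) (v w : B ⊕ I) :
    Differentiable ℂ fun γ : E → ℂ => lap ℂ head tail γ v w := by
  simp only [lap, Matrix.mul_apply (M := _ * _), Matrix.mul_diagonal]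
  fun_prop

/-- Polynomial harmonic extension. -/
def hatU (head tail : E → B ⊕ I) (γ : E → ℂ) (b : B) : B ⊕ I → ℂ :=
  Sum.elim (fun b' => if b' = b then (lapII ℂ head tail γ).det else 0)
    (fun j => -((lapII ℂ head tail γ).adjugate * lapIB ℂ head tail γ) j b)

theorem differentiable_hatU (head tail : E → B ⊕ I) (b : B) (v : B ⊕ I) :
    Differentiable ℂ fun γ : E → ℂ => hatU head tail γ b v := by
  rcases v with b' | j
  · simp only [hatU, Sum.elim_inl]
    split_ifs
    · exact differentiable_det _ fun i j => differentiable_lap head tail _ _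
    · fun_prop
  · simp only [hatU, Sum.elim_inr, Matrix.mul_apply]
    refine Differentiable.neg (Differentiable.fun_sum fun k _ => ?_)
    exact (differentiable_adj _ (fun i j => differentiable_lap head tail _ _) _ _).mul
      (differentiable_lap head tail _ _)

theorem harmonic_hatU (head tail : E → B ⊕ I) (γ : E → ℂ) (b : B) :
    Harmonic head tail γ 0 (hatU head tail γ b) := by
  intro i
  have h : (lapII ℂ head tail γ * ((lapII ℂ head tail γ).adjugate * lapIB ℂ head tail γ)) i b
      = (lapII ℂ head tail γ).det * lapIB ℂ head tail γ i b := by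
    rw [← Matrix.mul_assoc, Matrix.mul_adjugate]; simp
  rw [Matrix.mul_apply] at h
  simp only [Matrix.mulVec, dotProduct, Fintype.sum_sum_type, hatU, Sum.elim_inl, Sum.elim_inr,
    mul_ite, mul_zero, Finset.sum_ite_eq', Finset.sum_ite_eq, Finset.mem_univ, if_true, mul_neg,
    Finset.sum_neg_distrib, Pi.zero_apply, zero_mul, add_zero]
  simp only [lapII, lapIB, Matrix.submatrix_apply] at h ⊢
  rw [h]; ring

theorem incMat_mulVec (head tail : E → B ⊕ I) (u : B ⊕ I → ℂ) :
    (incMat ℂ head tail).mulVec u = grad head tail u := by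
  funext e
  simp [incMat, grad, Matrix.mulVec, dotProduct, sub_mul, Finset.sum_sub_distrib]

theorem energy_zero [Nonempty B] (head tail : E → B ⊕ I) (hG : Gconn head tail)
    (γ : E → ℂ) (hγ : ∀ e, 0 < (γ e).re) (x : B ⊕ I → ℂ) (hB : ∀ b, x (Sum.inl b) = 0)
    (hx : Harmonic head tail γ 0 x) : x = 0 := by
  have h0 : star x ⬝ᵥ (lap ℂ head tail γ).mulVec x = 0 := by
    refine Finset.sum_eq_zero fun v _ => ?_
    rcases v with b | i
    · simp [hB]
    · have := hx i
      simp only [Pi.zero_apply, zero_mul, add_zero] at this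
      rw [this, mul_zero]
  have h1 : star x ⬝ᵥ (lap ℂ head tail γ).mulVec x
      = ∑ e, γ e * ((Complex.normSq (grad head tail x e) : ℝ) : ℂ) := by
    rw [lap, ← Matrix.mulVec_mulVec, ← Matrix.mulVec_mulVec, Matrix.dotProduct_mulVec,
      Matrix.vecMul_transpose, incMat_mulVec, incMat_mulVec]
    refine Finset.sum_congr rfl fun e _ => ?_
    rw [Matrix.mulVec_diagonal, ← Complex.mul_conj]
    simp only [grad, Pi.star_apply, map_sub, RCLike.star_def]
    ring
  have h2 : ∑ e, (γ e).re * Complex.normSq (grad head tail x e) = 0 := by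
    have := congrArg Complex.re (h1.symm.trans h0)
    simpa using this
  have h3 : ∀ e, grad head tail x e = 0 := by
    intro e
    have := (Finset.sum_eq_zero_iff_of_nonneg
      (fun e _ => mul_nonneg (hγ e).le (Complex.normSq_nonneg _))).1 h2 e (Finset.mem_univ e)
    rcases mul_eq_zero.1 this with h | h
    · exact absurd h (hγ e).ne'
    · exact Complex.normSq_eq_zero.1 h
  have h4 : ∀ v w, (SimpleGraph.fromRel fun v w : B ⊕ I => ∃ e, head e = v ∧ tail e = w).Adj v w →
      x v = x w := by
    intro v w h
    rw [SimpleGraph.fromRel_adj] at h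
    rcases h with ⟨_, ⟨e, rfl, rfl⟩ | ⟨e, rfl, rfl⟩⟩
    · exact sub_eq_zero.1 (h3 e)
    · exact (sub_eq_zero.1 (h3 e)).symm
  obtain ⟨b⟩ := ‹Nonempty B›
  funext v
  obtain ⟨p⟩ := hG.preconnected v (Sum.inl b)
  have h5 : ∀ v w, (SimpleGraph.fromRel fun v w : B ⊕ I => ∃ e, head e = v ∧ tail e = w).Walk v w →
      x v = x w := by
    intro v w p
    induction p with
    | nil => rfl
    | cons h _ ih => exact (h4 _ _ h).trans ih
  rw [h5 _ _ p, hB]; rfl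

theorem det_ne [Nonempty B] (head tail : E → B ⊕ I) (hG : Gconn head tail)
    (γ : E → ℂ) (hγ : ∀ e, 0 < (γ e).re) : (lapII ℂ head tail γ).det ≠ 0 := by
  intro h
  obtain ⟨y, hy, h⟩ := Matrix.exists_mulVec_eq_zero_iff.2 h
  apply hy
  have := energy_zero head tail hG γ hγ (Sum.elim 0 y) (by simp) (by
    intro i
    have := congrFun h i
    simpa [Matrix.mulVec, dotProduct, lapII] using this)
  funext i
  exact congrFun this (Sum.inr i)

theorem harmonic_rep [Nonempty B] (head tail : E → B ⊕ I) (hG : Gconn head tail)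
    (γ : E → ℂ) (hγ : ∀ e, 0 < (γ e).re) (u : B ⊕ I → ℂ) (hu : Harmonic head tail γ 0 u) :
    ∃ c : B → ℂ, u = ∑ b, c b • hatU head tail γ b := by
  have hd := det_ne head tail hG γ hγ
  refine ⟨fun b => (lapII ℂ head tail γ).det⁻¹ * u (Sum.inl b), ?_⟩
  rw [← sub_eq_zero]
  refine energy_zero head tail hG γ hγ _ ?_ ?_
  · intro b
    simp [hatU, Finset.sum_apply]
    field_simp
    simp
  · intro i
    have h1 := hu i
    have h2 := fun b => harmonic_hatU head tail γ b i
    simp only [Pi.zero_apply, zero_mul, add_zero] at h1 h2 ⊢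
    rw [Matrix.mulVec_sub, Matrix.mulVec_sum]
    simp [Matrix.mulVec_smul, Finset.sum_apply, h1, h2]

/-- Polynomial version of the products-of-gradients matrix. -/
def hatF (head tail : E → B ⊕ I) (γ₁ γ₂ : E → ℂ) : Matrix E (B × B) ℂ :=
  Matrix.of fun e p => grad head tail (hatU head tail γ₁ p.1) e *
    grad head tail (hatU head tail γ₂ p.2) e

theorem exists_right_inv [Nonempty B] (head tail : E → B ⊕ I) (hG : Gconn head tail)
    (ρ₁ ρ₂ : E → ℂ) (hρ₁ : ∀ e, 0 < (ρ₁ e).re) (hρ₂ : ∀ e, 0 < (ρ₂ e).re)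
    (hP : Pspace head tail ρ₁ ρ₂ = ⊤) :
    ∃ X : Matrix (B × B) E ℂ, hatF head tail ρ₁ ρ₂ * X = 1 := by
  rw [← Matrix.mulVec_surjective_iff_exists_right_inverse]
  have : LinearMap.range (hatF head tail ρ₁ ρ₂).mulVecLin = ⊤ := by
    rw [eq_top_iff, ← hP, Pspace, Submodule.span_le]
    rintro w ⟨u, v, hu, hv, rfl⟩
    obtain ⟨c, rfl⟩ := harmonic_rep head tail hG ρ₁ hρ₁ u hu
    obtain ⟨d, rfl⟩ := harmonic_rep head tail hG ρ₂ hρ₂ v hv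
    refine ⟨fun p => c p.1 * d p.2, ?_⟩
    funext e
    simp only [Matrix.mulVecLin_apply, Matrix.mulVec, dotProduct, hatF, Matrix.of_apply, grad,
      Finset.sum_apply, Pi.smul_apply, smul_eq_mul]
    rw [← Finset.sum_sub_distrib, ← Finset.sum_sub_distrib, Finset.sum_mul_sum,
      Fintype.sum_prod_type]
    refine Finset.sum_congr rfl fun _ _ => Finset.sum_congr rfl fun _ _ => ?_
    ring
  rw [LinearMap.range_eq_top] at this
  exact this

theorem Pspace_top (head tail : E → B ⊕ I) (γ₁ γ₂ : E → ℂ) (X : Matrix (B × B) E ℂ)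
    (h : (hatF head tail γ₁ γ₂ * X).det ≠ 0) : Pspace head tail γ₁ γ₂ = ⊤ := by
  rw [eq_top_iff]
  rintro w -
  have hu : IsUnit (hatF head tail γ₁ γ₂ * X).det := isUnit_iff_ne_zero.2 h
  have : w = (hatF head tail γ₁ γ₂).mulVec
      (X.mulVec ((hatF head tail γ₁ γ₂ * X)⁻¹.mulVec w)) := by
    rw [Matrix.mulVec_mulVec, Matrix.mulVec_mulVec, Matrix.mul_nonsing_inv _ hu,
      Matrix.one_mulVec]
  rw [this, Matrix.mulVec_eq_sum]
  simp only [op_smul_eq_smul]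
  refine Submodule.sum_mem _ fun p _ => Submodule.smul_mem _ _ (Submodule.subset_span ?_)
  exact ⟨_, _, harmonic_hatU head tail γ₁ p.1, harmonic_hatU head tail γ₂ p.2, rfl⟩

/-- if `P(ρ₁,ρ₂) = ℂ^E` for some `ρ₁,ρ₂ ∈ ℂ_0^E`, then the set of
`(γ₁,γ₂) ∈ ℂ_0^E × ℂ_0^E` with `P(γ₁,γ₂) ≠ ℂ^E` has Lebesgue measure zero. -/
theorem uniqueness_ae_cond [Nonempty B] (head tail : E → B ⊕ I)
    (hG : Gconn head tail) (hGI : GIconn head tail)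
    (ρ₁ ρ₂ : E → ℂ) (hρ₁ : ∀ e, 0 < (ρ₁ e).re) (hρ₂ : ∀ e, 0 < (ρ₂ e).re)
    (hP : Pspace head tail ρ₁ ρ₂ = ⊤) :
    volume { p : (E → ℂ) × (E → ℂ) |
      (∀ e, 0 < (p.1 e).re) ∧ (∀ e, 0 < (p.2 e).re) ∧
        Pspace head tail p.1 p.2 ≠ ⊤ } = 0 := by
  obtain ⟨X, hX⟩ := exists_right_inv head tail hG ρ₁ ρ₂ hρ₁ hρ₂ hP
  have key := nullZ_prod (nullZ_pi E) (nullZ_pi E)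
    (fun p => (hatF head tail p.1 p.2 * X).det) (by
      refine differentiable_det _ fun i j => ?_
      simp only [Matrix.mul_apply, hatF, Matrix.of_apply, grad]
      have h := fun b v => differentiable_hatU head tail b v
      have h1 : ∀ b v, Differentiable ℂ fun p : (E → ℂ) × (E → ℂ) => hatU head tail p.1 b v :=
        fun b v => (h b v).comp differentiable_fst
      have h2 : ∀ b v, Differentiable ℂ fun p : (E → ℂ) × (E → ℂ) => hatU head tail p.2 b v :=
        fun b v => (h b v).comp differentiable_snd
      refine Differentiable.fun_sum fun k _ => ?_
      exact (((h1 _ _).sub (h1 _ _)).mul ((h2 _ _).sub (h2 _ _))).mul_const _)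
    ⟨(ρ₁, ρ₂), by simp [hX]⟩
  refine measure_mono_null ?_ key
  rintro p ⟨-, -, hp⟩
  by_contra h
  exact hp (Pspace_top head tail p.1 p.2 X h)

end

end DIP
end

section
/- Let γ ∈ ℂ_0^E and q ∈ ℂ^I be such that the Dirichlet problem for (γ,q) is well-posed, let δq ∈ ℂ^I, let u_B, v_B ∈ ℂ^B, and let u, v ∈ ℂ^V be the unique (γ,q)-harmonic functions with boundary values u_B and v_B respectively. Then the function t ↦ u_B^T Λ_{γ, q + tδq} v_B, defined for complex t in a neighborhood of 0, is differentiable at t = 0 with derivative (δq)^T (u_I ⊙ v_I). -/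
/-!
Common setup: a finite graph whose vertex set is partitioned into boundary
nodes `B` and interior nodes `I` (so the vertex set is `B ⊕ I`), with edge
set `E` and a fixed orientation given by maps `head tail : E → B ⊕ I`.
-/

open Matrix MeasureTheory

namespace DIP

noncomputable section

variable {B I E : Type*} [Fintype B] [Fintype I] [Fintype E]
  [DecidableEq B] [DecidableEq I] [DecidableEq E]

section aux
attribute [local instance] Matrix.linftyOpNormedRing Matrix.linftyOpNormedAlgebra

theorem hasDerivAt_inv_aux {n : Type*} [Fintype n] [DecidableEq n] (A D : Matrix n n ℂ)
    (hA : IsUnit A) (g : Matrix n n ℂ →ₗ[ℂ] ℂ) :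
    HasDerivAt (fun t : ℂ => g ((A + t • D)⁻¹)) (-(g (A⁻¹ * D * A⁻¹))) 0 := by
  obtain ⟨U, rfl⟩ := hA
  have h1 : HasDerivAt (fun t : ℂ => (U : Matrix n n ℂ) + t • D) D 0 := by
    have h0 := ((hasDerivAt_id (0 : ℂ)).smul_const D).const_add (U : Matrix n n ℂ)
    exact h0.congr_deriv (one_smul ℂ D)
  have h2 := hasFDerivAt_ringInverse (𝕜 := ℂ) U
  have h2' : HasFDerivAt (Ring.inverse : Matrix n n ℂ → Matrix n n ℂ)
      (-ContinuousLinearMap.mulLeftRight ℂ (Matrix n n ℂ) ↑U⁻¹ ↑U⁻¹)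
      ((U : Matrix n n ℂ) + (0 : ℂ) • D) := by simpa using h2
  have h3 := h2'.comp_hasDerivAt (0 : ℂ) h1
  have h4 := (LinearMap.toContinuousLinearMap g).hasFDerivAt.comp_hasDerivAt (0 : ℂ) h3
  refine (h4.congr_deriv ?_).congr_of_eventuallyEq (Filter.Eventually.of_forall fun t => ?_)
  · simp [Matrix.coe_units_inv]
    exact map_neg g _
  · simp [Matrix.nonsing_inv_eq_ringInverse]

end aux

theorem lap_symm_aux (head tail : E → B ⊕ I) (γ : E → ℂ) :
    (lap ℂ head tail γ)ᵀ = lap ℂ head tail γ := by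
  simp [lap, Matrix.transpose_mul, Matrix.mul_assoc]

theorem harm_aux (head tail : E → B ⊕ I) (γ : E → ℂ) (q : I → ℂ) (uB : B → ℂ) (u : B ⊕ I → ℂ)
    (hu : Harmonic head tail γ q u) (huB : ∀ b, u (Sum.inl b) = uB b) :
    lapIB ℂ head tail γ *ᵥ uB =
      -((lapII ℂ head tail γ + Matrix.diagonal q) *ᵥ fun i => u (Sum.inr i)) := by
  funext i
  have h := hu i
  simp only [Matrix.mulVec, dotProduct, Fintype.sum_sum_type, huB] at h
  rw [Matrix.add_mulVec]
  simp only [Pi.neg_apply, Pi.add_apply, Matrix.mulVec_diagonal]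
  simp only [Matrix.mulVec, dotProduct, lapIB, lapII, Matrix.submatrix_apply]
  linear_combination h

/-- `t ↦ u_Bᵀ Λ_{γ, q + tδq} v_B` is differentiable at `t = 0`
with derivative `(δq)ᵀ (u_I ⊙ v_I)`. -/
theorem linearization_schroe [Nonempty B] (head tail : E → B ⊕ I)
    (γ : E → ℂ) (hγ : ∀ e, 0 < (γ e).re)
    (q : I → ℂ) (hwp : IsUnit (lapII ℂ head tail γ + Matrix.diagonal q))
    (δq : I → ℂ) (uB vB : B → ℂ) (u v : B ⊕ I → ℂ)
    (hu : Harmonic head tail γ q u) (huB : ∀ b, u (Sum.inl b) = uB b)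
    (hv : Harmonic head tail γ q v) (hvB : ∀ b, v (Sum.inl b) = vB b) :
    HasDerivAt (fun t : ℂ => uB ⬝ᵥ (dtn head tail γ (fun i => q i + t * δq i)).mulVec vB)
      (δq ⬝ᵥ fun i => u (Sum.inr i) * v (Sum.inr i)) 0 := by
  set A := lapII ℂ head tail γ + Matrix.diagonal q with hAdef
  let g : Matrix I I ℂ →ₗ[ℂ] ℂ :=
    { toFun := fun X => (lapIB ℂ head tail γ *ᵥ uB) ⬝ᵥ (X *ᵥ (lapIB ℂ head tail γ *ᵥ vB))
      map_add' := by intro X Y; rw [Matrix.add_mulVec, dotProduct_add]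
      map_smul' := by intro c X; rw [Matrix.smul_mulVec, dotProduct_smul]; rfl }
  have hBI : lapBI ℂ head tail γ = (lapIB ℂ head tail γ)ᵀ := by
    conv_lhs => rw [lapBI, ← lap_symm_aux]
    rfl
  have hAs : Aᵀ = A := by
    rw [hAdef, Matrix.transpose_add, Matrix.diagonal_transpose]
    conv_rhs => rw [lapII, ← lap_symm_aux]
    rfl
  have hdet : IsUnit A.det := (Matrix.isUnit_iff_isUnit_det A).mp hwp
  have key := (hasDerivAt_inv_aux A (Matrix.diagonal δq) hwp g).const_sub
    (uB ⬝ᵥ (lapBB ℂ head tail γ *ᵥ vB))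
  refine (key.congr_deriv ?_).congr_of_eventuallyEq (Filter.Eventually.of_forall fun t => ?_)
  · symm
    have : g (A⁻¹ * Matrix.diagonal δq * A⁻¹) = (lapIB ℂ head tail γ *ᵥ uB) ⬝ᵥ
      ((A⁻¹ * Matrix.diagonal δq * A⁻¹) *ᵥ (lapIB ℂ head tail γ *ᵥ vB)) := rfl
    rw [neg_neg, this, harm_aux head tail γ q uB u hu huB, harm_aux head tail γ q vB v hv hvB,
      ← hAdef, Matrix.mulVec_neg, neg_dotProduct_neg, Matrix.mulVec_mulVec,
      Matrix.mul_assoc, Matrix.nonsing_inv_mul _ hdet, Matrix.mul_one,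
      Matrix.dotProduct_mulVec]
    have h5 : (A *ᵥ fun i => u (Sum.inr i)) = (fun i => u (Sum.inr i)) ᵥ* A := by
      conv_lhs => rw [← hAs, Matrix.mulVec_transpose]
    rw [h5, Matrix.vecMul_vecMul, ← Matrix.mul_assoc, Matrix.mul_nonsing_inv _ hdet,
      Matrix.one_mul]
    simp only [dotProduct, Matrix.vecMul_diagonal]
    exact Finset.sum_congr rfl fun i _ => by ring
  · show uB ⬝ᵥ (dtn head tail γ (fun i => q i + t * δq i)).mulVec vB =
      uB ⬝ᵥ (lapBB ℂ head tail γ *ᵥ vB) - g ((A + t • Matrix.diagonal δq)⁻¹)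
    have hd : lapII ℂ head tail γ + Matrix.diagonal (fun i => q i + t * δq i)
        = A + t • Matrix.diagonal δq := by
      rw [hAdef, add_assoc, ← Matrix.diagonal_smul, Matrix.diagonal_add]
      rfl
    have : g ((A + t • Matrix.diagonal δq)⁻¹) = (lapIB ℂ head tail γ *ᵥ uB) ⬝ᵥ
      ((A + t • Matrix.diagonal δq)⁻¹ *ᵥ (lapIB ℂ head tail γ *ᵥ vB)) := rfl
    rw [this, dtn, hd, hBI, Matrix.sub_mulVec, dotProduct_sub, ← Matrix.mulVec_mulVec,
      ← Matrix.mulVec_mulVec, Matrix.dotProduct_mulVec uB (lapIB ℂ head tail γ)ᵀ,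
      Matrix.vecMul_transpose]

end

end DIP
end
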